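/- Let E be a Dedekind complete vector lattice. If (S_α) and (T_β) are nets in Orth(E) that are unbounded order convergent in L_ob(E) to S and T in L_ob(E) respectively, then S and T are orthomorphisms and the net (S_α T_β) is unbounded order convergent to S T in L_ob(E). -/

import Mathlib

open Filter

section Defs

variable {E : Type*} [Lattice E] [AddCommGroup E]
  [CovariantClass E E (· + ·) (· ≤ ·)]

/-- Order convergence of a net, via a downward directed set of dominating elements
with infimum `0` (equivalent to the usual definition with an auxiliary net `y_β ↓ 0`). -/
def OrderTendsto {ι : Type*} [Preorder ι] (x : ι → E) (l : E) : Prop :=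
  ∃ D : Set E, D.Nonempty ∧ DirectedOn (· ≥ ·) D ∧ IsGLB D 0 ∧
    ∀ d ∈ D, ∃ a0 : ι, ∀ a : ι, a0 ≤ a → |x a - l| ≤ d

/-- Unbounded order convergence of a net. -/
def UOTendsto {ι : Type*} [Preorder ι] (x : ι → E) (l : E) : Prop :=
  ∀ y : E, 0 ≤ y → OrderTendsto (fun a => |x a - l| ⊓ y) 0

/-- Dedekind completeness. -/
def DedekindComplete (E : Type*) [Preorder E] : Prop :=
  ∀ s : Set E, s.Nonempty → BddAbove s → ∃ u, IsLUB s u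

variable [Module ℝ E]

/-- An order bounded linear operator. -/
def IsOrderBoundedMap (f : E →ₗ[ℝ] E) : Prop :=
  ∀ x : E, 0 ≤ x → ∃ b : E, ∀ y ∈ Set.Icc (-x) x, |f y| ≤ b

/-- An orthomorphism: an order bounded, band preserving linear operator. -/
def IsOrthomorphism (f : E →ₗ[ℝ] E) : Prop :=
  IsOrderBoundedMap f ∧ ∀ x y : E, |x| ⊓ |y| = 0 → |f x| ⊓ |y| = 0

/-- An order continuous linear operator. -/
def IsOrderContinuousMap (f : E →ₗ[ℝ] E) : Prop :=
  ∀ {ι : Type*} [Preorder ι] (x : ι → E) (l : E),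
    OrderTendsto x l → OrderTendsto (fun a => f (x a)) (f l)

end Defs

/-- `(𝕃, j)` is a realization of the vector lattice `L_ob(E)` of order bounded
linear operators on `E`: `j` is an injective linear map onto the order bounded
operators, and the order of `𝕃` is the operator order. -/
structure IsLobLattice (E 𝕃 : Type*) [Lattice E] [AddCommGroup E]
    [CovariantClass E E (· + ·) (· ≤ ·)] [Module ℝ E]
    [Lattice 𝕃] [AddCommGroup 𝕃] [Module ℝ 𝕃]
    (j : 𝕃 →ₗ[ℝ] E →ₗ[ℝ] E) : Prop where
  inj : Function.Injective j
  mem_range_iff : ∀ f : E →ₗ[ℝ] E, (∃ S, j S = f) ↔ IsOrderBoundedMap f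
  le_iff : ∀ S T : 𝕃, S ≤ T ↔ ∀ x : E, 0 ≤ x → j S x ≤ j T x

section LatticeGroup

theorem inf_eq_zero_of_le {G : Type*} [Lattice G] [Zero G] {a b c : G} (ha : 0 ≤ a)
    (hab : a ≤ b) (hc : 0 ≤ c) (h : b ⊓ c = 0) : a ⊓ c = 0 :=
  le_antisymm (h ▸ inf_le_inf_right c hab) (le_inf ha hc)

theorem eq_zero_of_le_of_inf_eq_zero {G : Type*} [Lattice G] [Zero G] {a b : G}
    (hab : a ⊓ b = 0) (h : a ≤ b) : a = 0 := by
  rwa [inf_eq_left.2 h] at hab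

variable {G : Type*} [Lattice G] [AddCommGroup G] [IsOrderedAddMonoid G]

theorem inf_add_le_of_nonneg {a b c : G} (ha : 0 ≤ a) (hb : 0 ≤ b) (hc : 0 ≤ c) :
    a ⊓ (b + c) ≤ a ⊓ b + a ⊓ c := by
  rw [add_inf, inf_add, inf_add]
  refine le_inf (le_inf ?_ ?_) (le_inf ?_ inf_le_right)
  · exact inf_le_left.trans (le_add_of_nonneg_left ha)
  · exact inf_le_left.trans (le_add_of_nonneg_left hb)
  · exact inf_le_left.trans (le_add_of_nonneg_right hc)

theorem le_of_le_add_of_inf_eq_zero {a b c : G} (ha : 0 ≤ a) (hb : 0 ≤ b) (hc : 0 ≤ c)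
    (hac : a ⊓ c = 0) (h : a ≤ b + c) : a ≤ b := by
  have := inf_add_le_of_nonneg ha hb hc
  rw [inf_eq_left.2 h, hac, add_zero] at this
  exact this.trans inf_le_right

theorem inf_add_eq_zero {a b c : G} (ha : 0 ≤ a) (hb : 0 ≤ b) (hc : 0 ≤ c)
    (hab : a ⊓ b = 0) (hac : a ⊓ c = 0) : a ⊓ (b + c) = 0 := by
  refine le_antisymm ?_ (le_inf ha (add_nonneg hb hc))
  simpa [hab, hac] using inf_add_le_of_nonneg ha hb hc

theorem inf_nsmul_eq_zero {a b : G} (ha : 0 ≤ a) (hb : 0 ≤ b) (hab : a ⊓ b = 0) (n : ℕ) :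
    a ⊓ n • b = 0 := by
  induction n with
  | zero => simpa using ha
  | succ n ih =>
    rw [succ_nsmul]
    exact inf_add_eq_zero ha (nsmul_nonneg hb n) hb ih hab

theorem nonneg_of_succ_nsmul_nonneg {x : G} {n : ℕ} (h : 0 ≤ (n + 1) • x) : 0 ≤ x := by
  have hle : (n + 1) • x⁻ ≤ (n + 1) • x⁺ := by
    rw [← sub_nonneg, ← nsmul_sub, posPart_sub_negPart]
    exact h
  have hle' : x⁻ ≤ (n + 1) • x⁺ :=
    (le_self_nsmul (negPart_nonneg x) n.succ_ne_zero).trans hle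
  have hdisj : x⁻ ⊓ x⁺ = 0 := by rw [inf_comm, posPart_inf_negPart_eq_zero]
  exact negPart_eq_zero.1 (eq_zero_of_le_of_inf_eq_zero
    (inf_nsmul_eq_zero (negPart_nonneg x) (posPart_nonneg x) hdisj (n + 1)) hle')

theorem le_of_succ_nsmul_le {x y : G} {n : ℕ} (h : (n + 1) • x ≤ (n + 1) • y) : x ≤ y := by
  rw [← sub_nonneg] at h ⊢
  rw [← nsmul_sub] at h
  exact nonneg_of_succ_nsmul_nonneg h

theorem inf_nsmul_le {x y : G} (hx : 0 ≤ x) (hy : 0 ≤ y) (n : ℕ) :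
    x ⊓ n • y ≤ n • (x ⊓ y) := by
  induction n with
  | zero => simp
  | succ n ih =>
    rw [succ_nsmul, succ_nsmul]
    exact (inf_add_le_of_nonneg hx (nsmul_nonneg hy n) hy).trans (by gcongr)

theorem DedekindComplete.nonpos_of_forall_nsmul_le (hDC : DedekindComplete G) {x y : G}
    (h : ∀ n : ℕ, n • x ≤ y) : x ≤ 0 := by
  obtain ⟨s, hs⟩ := hDC (Set.range fun n : ℕ => n • x) (Set.range_nonempty _)
    ⟨y, by rintro _ ⟨n, rfl⟩; exact h n⟩
  have : s ≤ s - x := hs.2 (by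
    rintro _ ⟨n, rfl⟩
    rw [le_sub_iff_add_le, ← succ_nsmul]
    exact hs.1 ⟨n + 1, rfl⟩)
  simpa using this

/-- The components of `x` in the band generated by `u` and in its disjoint complement. -/
theorem DedekindComplete.exists_band_components (hDC : DedekindComplete G) {u : G} (hu : 0 ≤ u)
    {x : G} (hx : 0 ≤ x) :
    ∃ x₁ x₂ : G, 0 ≤ x₁ ∧ 0 ≤ x₂ ∧ x = x₁ + x₂ ∧ x₂ ⊓ u = 0 ∧
      ∀ v, 0 ≤ v → v ⊓ u = 0 → x₁ ⊓ v = 0 := by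
  obtain ⟨s, hs⟩ := hDC (Set.range fun n : ℕ => x ⊓ n • u) (Set.range_nonempty _)
    ⟨x, by rintro _ ⟨n, rfl⟩; exact inf_le_left⟩
  have hsx : s ≤ x := hs.2 (by rintro _ ⟨n, rfl⟩; exact inf_le_left)
  have hs0 : 0 ≤ s := by simpa [hx] using hs.1 ⟨0, rfl⟩
  refine ⟨s, x - s, hs0, sub_nonneg.2 hsx, by abel, ?_, fun v hv hvu => ?_⟩
  · refine le_antisymm ?_ (le_inf (sub_nonneg.2 hsx) hu)
    have : s ≤ s - (x - s) ⊓ u := hs.2 (by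
      rintro _ ⟨n, rfl⟩
      refine le_sub_iff_add_le.2 ((?_ : _ ≤ x ⊓ (n + 1) • u).trans (hs.1 ⟨n + 1, rfl⟩))
      refine le_inf ?_ ?_
      · calc x ⊓ n • u + (x - s) ⊓ u ≤ s + (x - s) := by
              gcongr
              · exact hs.1 ⟨n, rfl⟩
              · exact inf_le_left
          _ = x := by abel
      · rw [succ_nsmul]
        exact add_le_add inf_le_right inf_le_right)
    simpa using this
  · refine le_antisymm ?_ (le_inf hs0 hv)
    have : s ≤ s - s ⊓ v := hs.2 (by
      rintro _ ⟨n, rfl⟩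
      have h1 : (x ⊓ n • u) ⊓ (s ⊓ v) = 0 := by
        refine inf_eq_zero_of_le (le_inf hx (nsmul_nonneg hu n)) inf_le_right (le_inf hs0 hv) ?_
        rw [inf_comm]
        exact inf_eq_zero_of_le (le_inf hs0 hv) inf_le_right (nsmul_nonneg hu n)
          (inf_nsmul_eq_zero hv hu hvu n)
      rw [le_sub_iff_add_le, ← inf_add_sup (x ⊓ n • u), h1, zero_add]
      exact sup_le (hs.1 ⟨n, rfl⟩) inf_le_left)
    simpa using this

/-- If `a + b` is the sum of a positive and a negative element, the former disjoint from `b` and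
the latter from `a`, and `a`, `b` are disjoint, then `a` is positive. -/
theorem nonneg_of_add_eq_sub {a b p m : G} (hp : 0 ≤ p) (hm : 0 ≤ m) (h : a + b = p - m)
    (ham : |a| ⊓ m = 0) (hab : |a| ⊓ |b| = 0) : 0 ≤ a := by
  have h1 : a⁻ ≤ m + |b| := sup_le (by
    have : -a = b + m - p := by
      rw [eq_sub_iff_add_eq, ← sub_eq_zero]
      have h2 : a + b - (p - m) = 0 := sub_eq_zero.2 h
      rw [← neg_eq_zero, ← h2]; abel
    rw [this, sub_le_iff_le_add, add_comm b]
    exact (add_le_add_right (le_abs_self b) m).trans (le_add_of_nonneg_right hp))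
    (add_nonneg hm (abs_nonneg b))
  have h2 : a⁻ ⊓ (m + |b|) = 0 :=
    inf_eq_zero_of_le (negPart_nonneg a) (sup_le (neg_le_abs a) (abs_nonneg a))
      (add_nonneg hm (abs_nonneg b)) (inf_add_eq_zero (abs_nonneg a) hm (abs_nonneg b) ham hab)
  exact negPart_eq_zero.1 (eq_zero_of_le_of_inf_eq_zero h2 h1)

end LatticeGroup

section Orthomorphism

theorem IsOrthomorphism.neg {E : Type*} [Lattice E] [AddCommGroup E] [Module ℝ E]
    {f : E →ₗ[ℝ] E} (hf : IsOrthomorphism f) : IsOrthomorphism (-f) :=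
  ⟨fun x hx => by simpa using hf.1 x hx, fun x y h => by simpa using hf.2 x y h⟩

variable {E : Type*} [Lattice E] [AddCommGroup E] [IsOrderedAddMonoid E] [Module ℝ E]
  {f g : E →ₗ[ℝ] E}

theorem IsOrderBoundedMap.add (hf : IsOrderBoundedMap f) (hg : IsOrderBoundedMap g) :
    IsOrderBoundedMap (f + g) := fun x hx => by
  obtain ⟨b, hb⟩ := hf x hx
  obtain ⟨c, hc⟩ := hg x hx
  exact ⟨b + c, fun y hy => (abs_add_le _ _).trans (add_le_add (hb y hy) (hc y hy))⟩

theorem IsOrderBoundedMap.comp (hf : IsOrderBoundedMap f) (hg : IsOrderBoundedMap g) :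
    IsOrderBoundedMap (f.comp g) := fun x hx => by
  obtain ⟨b, hb⟩ := hg x hx
  have hb0 : 0 ≤ b := (abs_nonneg _).trans (hb x ⟨(neg_nonpos.2 hx).trans hx, le_rfl⟩)
  obtain ⟨c, hc⟩ := hf b hb0
  refine ⟨c, fun y hy => hc _ ⟨?_, (le_abs_self _).trans (hb y hy)⟩⟩
  exact neg_le.1 ((neg_le_abs _).trans (hb y hy))

theorem isOrderBoundedMap_zero : IsOrderBoundedMap (0 : E →ₗ[ℝ] E) :=
  fun _ _ => ⟨0, by simp⟩

theorem isOrderBoundedMap_id : IsOrderBoundedMap (LinearMap.id : E →ₗ[ℝ] E) :=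
  fun x _ => ⟨x, fun _ hy => abs_le'.2 ⟨hy.2, neg_le.1 hy.1⟩⟩

theorem IsOrthomorphism.abs_map_inf_eq_zero (hf : IsOrthomorphism f) {x y : E} (hx : 0 ≤ x)
    (hy : 0 ≤ y) (h : x ⊓ y = 0) : |f x| ⊓ y = 0 := by
  simpa [abs_of_nonneg hy] using hf.2 x y (by rwa [abs_of_nonneg hx, abs_of_nonneg hy])

theorem IsOrthomorphism.abs_map_inf_abs_map (hf : IsOrthomorphism f) {x y : E} (hx : 0 ≤ x)
    (hy : 0 ≤ y) (h : x ⊓ y = 0) : |f x| ⊓ |f y| = 0 := by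
  rw [inf_comm]
  refine hf.abs_map_inf_eq_zero hy (abs_nonneg _) ?_
  rw [inf_comm]
  exact hf.abs_map_inf_eq_zero hx hy h

theorem IsOrthomorphism.add (hf : IsOrthomorphism f) (hg : IsOrthomorphism g) :
    IsOrthomorphism (f + g) := by
  refine ⟨hf.1.add hg.1, fun x y h => ?_⟩
  refine inf_eq_zero_of_le (abs_nonneg _) (abs_add_le (f x) (g x)) (abs_nonneg y) ?_
  rw [inf_comm]
  refine inf_add_eq_zero (abs_nonneg y) (abs_nonneg _) (abs_nonneg _) ?_ ?_
  · rw [inf_comm, hf.2 x y h]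
  · rw [inf_comm, hg.2 x y h]

theorem IsOrthomorphism.comp (hf : IsOrthomorphism f) (hg : IsOrthomorphism g) :
    IsOrthomorphism (f.comp g) :=
  ⟨hf.1.comp hg.1, fun x y h => hf.2 _ y (hg.2 x y h)⟩

theorem isOrthomorphism_zero : IsOrthomorphism (0 : E →ₗ[ℝ] E) :=
  ⟨isOrderBoundedMap_zero, fun _ y _ => by simp⟩

theorem isOrthomorphism_id : IsOrthomorphism (LinearMap.id : E →ₗ[ℝ] E) :=
  ⟨isOrderBoundedMap_id, fun _ _ h => h⟩

theorem IsOrthomorphism.map_nonneg_of_add (hf : IsOrthomorphism f) {x y : E} (hx : 0 ≤ x)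
    (hy : 0 ≤ y) (h : x ⊓ y = 0) (hxy : 0 ≤ f (x + y)) : 0 ≤ f x ∧ 0 ≤ f y := by
  have h' := hf.abs_map_inf_abs_map hx hy h
  rw [map_add] at hxy
  refine ⟨nonneg_of_add_eq_sub (b := f y) hxy le_rfl (sub_zero _).symm (by simp) h',
    nonneg_of_add_eq_sub (b := f x) hxy le_rfl (by rw [sub_zero, add_comm]) (by simp) ?_⟩
  rwa [inf_comm]

/-- If `f x ≥ 0` then every `0 ≤ y ≤ n • x` is approximated from below, up to `x`, by an element
with positive image. -/
theorem IsOrthomorphism.exists_le_add_map_nonneg (hDC : DedekindComplete E)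
    (hf : IsOrthomorphism f) (n : ℕ) :
    ∀ x y : E, 0 ≤ x → 0 ≤ f x → 0 ≤ y → y ≤ n • x → ∃ z, z ≤ y ∧ y ≤ z + x ∧ 0 ≤ f z := by
  induction n with
  | zero =>
    intro x y hx _ hy hyx
    rw [zero_nsmul] at hyx
    exact ⟨0, hy, by simpa using hyx.trans hx, by simp⟩
  | succ n ih =>
    intro x y hx hfx hy hyx
    have hu := posPart_nonneg (y - x)
    have hu' := negPart_nonneg (y - x)
    have huu' := posPart_inf_negPart_eq_zero (y - x)
    have hsub := posPart_sub_negPart (y - x)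
    set u := (y - x)⁺
    set u' := (y - x)⁻
    obtain ⟨x₁, x₂, hx₁, hx₂, rfl, hx₂u, hx₁d⟩ := hDC.exists_band_components hu hx
    obtain ⟨y₁, y₂, hy₁, hy₂, rfl, hy₂u, hy₁d⟩ := hDC.exists_band_components hu hy
    have hfx₁ := (hf.map_nonneg_of_add hx₁ hx₂ (hx₁d x₂ hx₂ hx₂u) hfx).1
    have hxy₁ : x₁ ≤ y₁ := by
      refine le_of_le_add_of_inf_eq_zero hx₁ hy₁ (add_nonneg hy₂ hu') ?_ ?_
      · exact inf_add_eq_zero hx₁ hy₂ hu' (hx₁d y₂ hy₂ hy₂u)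
          (hx₁d u' hu' (by rwa [inf_comm]))
      · refine (le_add_of_nonneg_right hx₂).trans (?_ : x₁ + x₂ ≤ _)
        have : x₁ + x₂ = y₁ + (y₂ + u') - u := by
          rw [eq_sub_iff_add_eq, ← sub_eq_zero, ← sub_eq_zero.2 hsub]; abel
        rw [this]
        exact sub_le_self _ hu
    have hyx₂ : y₂ ≤ x₂ := by
      refine le_of_le_add_of_inf_eq_zero hy₂ hx₂ (add_nonneg hx₁ hu) ?_ ?_
      · refine inf_add_eq_zero hy₂ hx₁ hu ?_ hy₂u
        rw [inf_comm]
        exact hx₁d y₂ hy₂ hy₂u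
      · refine (le_add_of_nonneg_left hy₁).trans (?_ : y₁ + y₂ ≤ _)
        have : y₁ + y₂ = x₂ + (x₁ + u) - u' := by
          rw [eq_sub_iff_add_eq, ← sub_eq_zero, ← sub_eq_zero.2 hsub.symm]; abel
        rw [this]
        exact sub_le_self _ hu'
    have hyn : y₁ - x₁ ≤ n • x₁ := by
      rw [sub_le_iff_le_add, ← succ_nsmul]
      refine le_of_le_add_of_inf_eq_zero hy₁ (nsmul_nonneg hx₁ _) (nsmul_nonneg hx₂ (n + 1))
        (inf_nsmul_eq_zero hy₁ hx₂ (hy₁d x₂ hx₂ hx₂u) _) ?_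
      rw [← nsmul_add]
      exact (le_add_of_nonneg_right hy₂).trans hyx
    obtain ⟨z, hz₁, hz₂, hz₃⟩ := ih x₁ (y₁ - x₁) hx₁ hfx₁ (sub_nonneg.2 hxy₁) hyn
    refine ⟨z + x₁, (le_sub_iff_add_le.1 hz₁).trans (le_add_of_nonneg_right hy₂), ?_, ?_⟩
    · calc y₁ + y₂ ≤ (z + x₁ + x₁) + x₂ := add_le_add (sub_le_iff_le_add.1 hz₂) hyx₂
        _ = _ := by abel
    · rw [map_add]
      exact add_nonneg hz₃ hfx₁

theorem IsOrthomorphism.map_nonneg_of_le (hDC : DedekindComplete E) (hf : IsOrthomorphism f)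
    {x y : E} (hfx : 0 ≤ f x) (hy : 0 ≤ y) (hyx : y ≤ x) : 0 ≤ f y := by
  have hx := hy.trans hyx
  obtain ⟨b, hb⟩ := hf.1 x hx
  refine neg_nonpos.1 (hDC.nonpos_of_forall_nsmul_le (y := b) fun n => ?_)
  obtain ⟨z, hz₁, hz₂, hz₃⟩ := hf.exists_le_add_map_nonneg hDC n x (n • y) hx hfx
    (nsmul_nonneg hy n) (nsmul_le_nsmul_right hyx n)
  have h := hb (n • y - z) ⟨(neg_nonpos.2 hx).trans (sub_nonneg.2 hz₁), by
    rwa [sub_le_iff_le_add, add_comm]⟩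
  have h' := (neg_le_abs _).trans h
  rw [map_sub, map_nsmul, neg_sub] at h'
  rw [smul_neg]
  refine le_trans ?_ h'
  rw [neg_eq_zero_sub]
  exact sub_le_sub_right hz₃ _

theorem IsOrthomorphism.map_map_nonneg_of_map_nonneg (hDC : DedekindComplete E)
    (hf : IsOrthomorphism f) {y : E} (hy : 0 ≤ y) (hfy : 0 ≤ f y) : 0 ≤ f (f y) := by
  have hg := posPart_nonneg (y - f y)
  have hg' := negPart_nonneg (y - f y)
  have hgg' := posPart_inf_negPart_eq_zero (y - f y)
  have hsub := posPart_sub_negPart (y - f y)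
  set g := (y - f y)⁺
  set g' := (y - f y)⁻
  obtain ⟨y₁, y₂, hy₁, hy₂, hyy, hy₂g, hy₁d⟩ := hDC.exists_band_components hg hy
  obtain ⟨p₁, p₂, hp₁, hp₂, hpp, hp₂g, hp₁d⟩ := hDC.exists_band_components hg hfy
  obtain ⟨hfy₁, hfy₂⟩ := hf.map_nonneg_of_add hy₁ hy₂ (hy₁d y₂ hy₂ hy₂g) (hyy ▸ hfy)
  have hpy₁ : p₁ ≤ y₁ := by
    refine le_of_le_add_of_inf_eq_zero hp₁ hy₁ (add_nonneg hy₂ hg') ?_ ?_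
    · exact inf_add_eq_zero hp₁ hy₂ hg' (hp₁d y₂ hy₂ hy₂g) (hp₁d g' hg' (by rwa [inf_comm]))
    · calc p₁ ≤ f y := by rw [hpp]; exact le_add_of_nonneg_right hp₂
        _ = y₁ + (y₂ + g') - g := by
          rw [← add_assoc, ← hyy, eq_sub_iff_add_eq, ← sub_eq_zero, ← sub_eq_zero.2 hsub]; abel
        _ ≤ _ := sub_le_self _ hg
  have hyp₂ : y₂ ≤ p₂ := by
    refine le_of_le_add_of_inf_eq_zero hy₂ hp₂ (add_nonneg hp₁ hg) ?_ ?_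
    · refine inf_add_eq_zero hy₂ hp₁ hg ?_ hy₂g
      rw [inf_comm]
      exact hp₁d y₂ hy₂ hy₂g
    · calc y₂ ≤ y := by rw [hyy]; exact le_add_of_nonneg_left hy₁
        _ = p₂ + (p₁ + g) - g' := by
          rw [← add_assoc, add_comm p₂, ← hpp, eq_sub_iff_add_eq, ← sub_eq_zero,
            ← sub_eq_zero.2 hsub.symm]; abel
        _ ≤ _ := sub_le_self _ hg'
  have hfp₁ : 0 ≤ f p₁ := hf.map_nonneg_of_le hDC hfy₁ hp₁ hpy₁
  have hfp₂ : 0 ≤ f p₂ := by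
    obtain ⟨p₃, p₄, hp₃, hp₄, hpp₂, hp₄w, hp₃d⟩ :=
      hDC.exists_band_components (negPart_nonneg (f p₂)) hp₂
    obtain ⟨y₃, y₄, hy₃, hy₄, hyy₂, hy₄w, hy₃d⟩ :=
      hDC.exists_band_components (negPart_nonneg (f p₂)) hy₂
    have hyp₃ : y₃ ≤ p₃ := by
      refine le_of_le_add_of_inf_eq_zero hy₃ hp₃ hp₄ (hy₃d p₄ hp₄ hp₄w) ?_
      rw [← hpp₂]
      exact le_trans (by rw [hyy₂]; exact le_add_of_nonneg_right hy₄) hyp₂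
    have hdisj := hf.abs_map_inf_abs_map hp₃ hp₄ (hp₃d p₄ hp₄ hp₄w)
    have hsum : f p₃ + f p₄ = (f p₂)⁺ - (f p₂)⁻ := by
      rw [posPart_sub_negPart, ← map_add, ← hpp₂]
    have hfp₄ : 0 ≤ f p₄ :=
      nonneg_of_add_eq_sub (b := f p₃) (posPart_nonneg _) (negPart_nonneg (f p₂))
        (by rw [add_comm, hsum]) (hf.abs_map_inf_eq_zero hp₄ (negPart_nonneg _) hp₄w)
        (by rwa [inf_comm])
    have hfp₃ : 0 ≤ (-f) p₃ := by
      refine nonneg_of_add_eq_sub (b := -f p₄) (negPart_nonneg (f p₂)) (posPart_nonneg (f p₂))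
        ?_ ?_ ?_
      · rw [LinearMap.neg_apply, ← neg_add, hsum, neg_sub]
      · rw [LinearMap.neg_apply, abs_neg]
        refine hf.abs_map_inf_eq_zero hp₃ (posPart_nonneg _) (hp₃d _ (posPart_nonneg _) ?_)
        exact posPart_inf_negPart_eq_zero _
      · rwa [LinearMap.neg_apply, abs_neg, abs_neg]
    have hfy₃ : f y₃ = 0 := by
      refine le_antisymm ?_ ?_
      · simpa using hf.neg.map_nonneg_of_le hDC hfp₃ hy₃ hyp₃
      · exact (hf.map_nonneg_of_add hy₃ hy₄ (hy₃d y₄ hy₄ hy₄w) (hyy₂ ▸ hfy₂)).1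
    have hp₃p₂ : p₃ ≤ p₂ := by rw [hpp₂]; exact le_add_of_nonneg_right hp₄
    have hp₃g : p₃ ⊓ g = 0 := inf_eq_zero_of_le hp₃ hp₃p₂ hg hp₂g
    have hp₃0 : p₃ = 0 := by
      refine eq_zero_of_le_of_inf_eq_zero (b := |f y₁| + |f y₄|)
        (inf_add_eq_zero hp₃ (abs_nonneg _) (abs_nonneg _) ?_ ?_) ?_
      · rw [inf_comm]
        exact hf.abs_map_inf_eq_zero hy₁ hp₃ (hy₁d p₃ hp₃ hp₃g)
      · rw [inf_comm]
        refine hf.abs_map_inf_eq_zero hy₄ hp₃ ?_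
        rw [inf_comm]
        exact hp₃d y₄ hy₄ hy₄w
      · calc p₃ ≤ f y := hp₃p₂.trans (by rw [hpp]; exact le_add_of_nonneg_left hp₁)
          _ = f y₁ + f y₄ := by rw [hyy, hyy₂, map_add, map_add, hfy₃, zero_add]
          _ ≤ _ := add_le_add (le_abs_self _) (le_abs_self _)
    rw [hpp₂, hp₃0, zero_add]
    exact hfp₄
  rw [hpp, map_add]
  exact add_nonneg hfp₁ hfp₂

theorem IsOrthomorphism.map_map_nonneg (hDC : DedekindComplete E) (hf : IsOrthomorphism f)
    {x : E} (hx : 0 ≤ x) : 0 ≤ f (f x) := by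
  have hpm := posPart_inf_negPart_eq_zero (f x)
  have hp := posPart_nonneg (f x)
  have hm := negPart_nonneg (f x)
  obtain ⟨x₁, x₂, hx₁, hx₂, hxx, hx₂u, hx₁d⟩ := hDC.exists_band_components hp hx
  have hdisj := hf.abs_map_inf_abs_map hx₁ hx₂ (hx₁d x₂ hx₂ hx₂u)
  have hsum : f x₁ + f x₂ = (f x)⁺ - (f x)⁻ := by rw [posPart_sub_negPart, ← map_add, ← hxx]
  have h₁ : 0 ≤ f x₁ := by
    refine nonneg_of_add_eq_sub hp hm hsum ?_ hdisj
    exact hf.abs_map_inf_eq_zero hx₁ hm (hx₁d _ hm (by rwa [inf_comm]))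
  have h₂ : 0 ≤ (-f) x₂ := by
    refine nonneg_of_add_eq_sub (b := -f x₁) hm hp ?_ ?_ ?_
    · rw [LinearMap.neg_apply, ← neg_add, add_comm, hsum, neg_sub]
    · rw [LinearMap.neg_apply, abs_neg]
      exact hf.abs_map_inf_eq_zero hx₂ hp hx₂u
    · rwa [LinearMap.neg_apply, abs_neg, abs_neg, inf_comm]
  have h₁' := hf.map_map_nonneg_of_map_nonneg hDC hx₁ h₁
  have h₂' := hf.neg.map_map_nonneg_of_map_nonneg hDC hx₂ h₂
  rw [hxx, map_add, map_add]
  exact add_nonneg h₁' (by simpa using h₂')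

theorem IsOrthomorphism.nonneg_of_add_map_nonneg (hf : IsOrthomorphism f)
    (hpos : ∀ x, 0 ≤ x → 0 ≤ f x) {z : E} (h : 0 ≤ z + f z) : 0 ≤ z := by
  have hp := posPart_nonneg z
  have hm := negPart_nonneg z
  have hmp : z⁻ ⊓ z⁺ = 0 := by rw [inf_comm, posPart_inf_negPart_eq_zero]
  refine negPart_eq_zero.1 (eq_zero_of_le_of_inf_eq_zero (b := z⁺ + f z⁺) ?_ ?_)
  · refine inf_add_eq_zero hm hp (hpos _ hp) hmp ?_
    have := hf.abs_map_inf_eq_zero hp hm (posPart_inf_negPart_eq_zero z)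
    rwa [abs_of_nonneg (hpos _ hp), inf_comm] at this
  · refine (le_add_of_nonneg_right (hpos _ hm)).trans (?_ : z⁻ + f z⁻ ≤ _)
    rw [← sub_nonneg]
    convert h using 1
    conv_rhs => rw [← posPart_sub_negPart z, map_sub]
    abel

end Orthomorphism

section OrthSubring

/-- The properties of the subring of orthomorphisms in the ring of order bounded operators
that govern unbounded order convergence. -/
structure IsOrthSubring {R : Type*} [Ring R] [Lattice R] (A : Subring R) : Prop where
  arch : ∀ x y : R, (∀ n : ℕ, n • x ≤ y) → x ≤ 0
  div : ∀ (n : ℕ) (x : R), ∃ w, (n + 1) • w = x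
  one_nonneg : (0 : R) ≤ 1
  mul_nonneg : ∀ x y : R, 0 ≤ x → 0 ≤ y → 0 ≤ x * y
  sq_nonneg : ∀ x ∈ A, 0 ≤ x * x
  solid : ∀ x : R, ∀ z ∈ A, |x| ≤ z → x ∈ A
  left_cancel : ∀ c ∈ A, 0 ≤ c → ∀ x ∈ A, 0 ≤ (1 + c) * x → 0 ≤ x
  right_cancel : ∀ c ∈ A, 0 ≤ c → ∀ x ∈ A, 0 ≤ x * (1 + c) → 0 ≤ x
  mem_of_forall_le_sq : ∀ x : R, 0 ≤ x → (∀ n : ℕ, (2 * n) • x ≤ x * x + (n * n) • 1) → x ∈ A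

theorem sub_nsmul_one_mul_self {R : Type*} [Ring R] (x : R) (n : ℕ) :
    (x - n • 1) * (x - n • 1) = x * x + (n * n) • 1 - (2 * n) • x := by
  simp only [sub_mul, mul_sub, smul_mul_assoc, mul_smul_comm, one_mul, mul_one, smul_sub,
    smul_smul, two_mul, add_smul]
  abel

namespace IsOrthSubring

variable {R : Type*} [Ring R] [Lattice R] [IsOrderedAddMonoid R] {A : Subring R}

theorem mem_of_nonneg_of_le (hA : IsOrthSubring A) {x z : R} (hx : 0 ≤ x) (hxz : x ≤ z)
    (hz : z ∈ A) : x ∈ A :=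
  hA.solid x z hz (by rwa [abs_of_nonneg hx])

theorem mul_le_mul_left (hA : IsOrthSubring A) {x y c : R} (hc : 0 ≤ c) (h : x ≤ y) :
    c * x ≤ c * y := by
  have := hA.mul_nonneg c (y - x) hc (sub_nonneg.2 h)
  rwa [mul_sub, sub_nonneg] at this

theorem mul_le_mul_right (hA : IsOrthSubring A) {x y c : R} (hc : 0 ≤ c) (h : x ≤ y) :
    x * c ≤ y * c := by
  have := hA.mul_nonneg (y - x) c (sub_nonneg.2 h) hc
  rwa [sub_mul, sub_nonneg] at this

theorem abs_mul_le (hA : IsOrthSubring A) (x y : R) : |x * y| ≤ |x| * |y| := by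
  have hx := sub_nonneg.2 (le_abs_self x)
  have hx' := neg_le_iff_add_nonneg.1 (neg_le_abs x)
  have hy := sub_nonneg.2 (le_abs_self y)
  have hy' := neg_le_iff_add_nonneg.1 (neg_le_abs y)
  refine abs_le'.2 ⟨?_, ?_⟩
  · refine le_of_succ_nsmul_le (n := 1) (sub_nonneg.1 ?_)
    convert add_nonneg (hA.mul_nonneg _ _ hx hy') (hA.mul_nonneg _ _ hx' hy) using 1
    noncomm_ring
  · refine le_of_succ_nsmul_le (n := 1) (sub_nonneg.1 ?_)
    convert add_nonneg (hA.mul_nonneg _ _ hx hy) (hA.mul_nonneg _ _ hx' hy') using 1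
    noncomm_ring

theorem nsmul_two_mul_le (hA : IsOrthSubring A) {x : R} (hx : x ∈ A) (n : ℕ) :
    (2 * n) • x ≤ x * x + (n * n) • 1 := by
  rw [← sub_nonneg, ← sub_nsmul_one_mul_self]
  exact hA.sq_nonneg (x - n • 1) (A.sub_mem hx (A.nsmul_mem A.one_mem n))

theorem abs_mem (hA : IsOrthSubring A) {x : R} (hx : x ∈ A) : |x| ∈ A := by
  have h1 : ∀ z ∈ A, z ≤ 1 + z * z + z * z := fun z hz => by
    refine le_of_succ_nsmul_le (n := 1) ((hA.nsmul_two_mul_le hz 1).trans ?_)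
    rw [one_mul, one_smul, one_add_one_eq_two, two_nsmul, add_comm (z * z)]
    have h0 := add_nonneg hA.one_nonneg (hA.sq_nonneg z hz)
    have h2 := le_add_of_nonneg_right (a := 1 + z * z) (hA.sq_nonneg z hz)
    exact h2.trans (le_add_of_nonneg_right (h0.trans h2))
  refine hA.mem_of_nonneg_of_le (z := 1 + x * x + x * x) (abs_nonneg x)
    (abs_le'.2 ⟨h1 x hx, ?_⟩) (A.add_mem (A.add_mem A.one_mem (A.mul_mem hx hx)) (A.mul_mem hx hx))
  simpa using h1 (-x) (A.neg_mem hx)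

/-- Division by a positive integer inside an infimum. -/
theorem nonpos_of_forall_le_nsmul (hA : IsOrthSubring A) {D : Set R} (hD : IsGLB D 0) {n : ℕ}
    {z : R} (h : ∀ d ∈ D, z ≤ (n + 1) • d) : z ≤ 0 := by
  obtain ⟨w, rfl⟩ := hA.div n z
  have hw : w ≤ 0 := hD.2 fun d hd => le_of_succ_nsmul_le (h d hd)
  exact nsmul_nonpos hw _

/-- Left and right multiplication by `1 + c` reflect infima equal to zero. -/
theorem nonpos_of_forall_le_map (hA : IsOrthSubring A) (L : R →+ R)
    (hLA : ∀ x ∈ A, L x ∈ A) (hLpos : ∀ x, 0 ≤ x → 0 ≤ L x)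
    (hL : ∀ x ∈ A, 0 ≤ L x → 0 ≤ x)
    (hLsq : ∀ r ∈ A, 0 ≤ r → ∀ n : ℕ, 0 ≤ L (L r) - (2 * n) • L r + (n * n) • r)
    {D : Set R} (hDA : D ⊆ A) (hDne : D.Nonempty) (hD : IsGLB D 0) {z : R}
    (hz : ∀ d ∈ D, z ≤ L d) : z ≤ 0 := by
  have h : ∀ d ∈ D, z ⊔ 0 ≤ L d := fun d hd => sup_le (hz d hd) (hLpos d (hD.1 hd))
  have hr : 0 ≤ z ⊔ 0 := le_sup_right
  have hrA : z ⊔ 0 ∈ A := by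
    obtain ⟨d, hd⟩ := hDne
    exact hA.mem_of_nonneg_of_le hr (h d hd) (hLA d (hDA hd))
  refine le_sup_left.trans (?_ : z ⊔ 0 ≤ 0)
  generalize z ⊔ 0 = r at *
  have key : ∀ n : ℕ, (2 * (n + 1)) • r ≤ L r := fun n => by
    rw [← sub_nonpos]
    have : ∀ d ∈ D, (2 * (n + 1)) • r - L r ≤ ((n + 1) * (n + 1)) • d := fun d hd => by
      rw [← sub_nonneg]
      refine hL _ (A.sub_mem (A.nsmul_mem (hDA hd) _)
        (A.sub_mem (A.nsmul_mem hrA _) (hLA r hrA))) ?_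
      refine (hLsq r hrA hr (n + 1)).trans ?_
      rw [map_sub, map_sub, map_nsmul, map_nsmul]
      have : ((n + 1) * (n + 1)) • r ≤ ((n + 1) * (n + 1)) • L d :=
        nsmul_le_nsmul_right (h d hd) _
      rw [← sub_nonneg] at this ⊢
      convert this using 1
      abel
    exact hA.nonpos_of_forall_le_nsmul (n := n * n + 2 * n) hD
      (fun d hd => (this d hd).trans_eq (by congr 1; ring))
  refine hA.arch r (L r) fun n => le_trans ?_ (key n)
  exact nsmul_le_nsmul_left hr (by omega)

theorem nonpos_of_forall_le_mul_left (hA : IsOrthSubring A) {c : R} (hcA : c ∈ A) (hc : 0 ≤ c)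
    {D : Set R} (hDA : D ⊆ A) (hDne : D.Nonempty) (hD : IsGLB D 0) {z : R}
    (h : ∀ d ∈ D, z ≤ (1 + c) * d) : z ≤ 0 := by
  have h1c : 1 + c ∈ A := A.add_mem A.one_mem hcA
  have h1c0 : 0 ≤ 1 + c := add_nonneg hA.one_nonneg hc
  refine hA.nonpos_of_forall_le_map (AddMonoidHom.mulLeft (1 + c)) (fun x hx => A.mul_mem h1c hx)
    (fun x hx => hA.mul_nonneg _ x h1c0 hx) (hA.left_cancel c hcA hc) (fun r _ hr n => ?_)
    hDA hDne hD h
  have hsq := hA.sq_nonneg (1 + c - n • 1) (A.sub_mem h1c (A.nsmul_mem A.one_mem n))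
  convert hA.mul_nonneg _ r hsq hr using 1
  rw [sub_nsmul_one_mul_self, sub_mul, add_mul, smul_mul_assoc, smul_mul_assoc, one_mul]
  simp only [AddMonoidHom.coe_mulLeft, mul_assoc]
  abel

theorem nonpos_of_forall_le_mul_right (hA : IsOrthSubring A) {c : R} (hcA : c ∈ A) (hc : 0 ≤ c)
    {D : Set R} (hDA : D ⊆ A) (hDne : D.Nonempty) (hD : IsGLB D 0) {z : R}
    (h : ∀ d ∈ D, z ≤ d * (1 + c)) : z ≤ 0 := by
  have h1c : 1 + c ∈ A := A.add_mem A.one_mem hcA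
  have h1c0 : 0 ≤ 1 + c := add_nonneg hA.one_nonneg hc
  refine hA.nonpos_of_forall_le_map (AddMonoidHom.mulRight (1 + c)) (fun x hx => A.mul_mem hx h1c)
    (fun x hx => hA.mul_nonneg x _ hx h1c0) (hA.right_cancel c hcA hc) (fun r _ hr n => ?_)
    hDA hDne hD h
  have hsq := hA.sq_nonneg (1 + c - n • 1) (A.sub_mem h1c (A.nsmul_mem A.one_mem n))
  convert hA.mul_nonneg r _ hr hsq using 1
  rw [sub_nsmul_one_mul_self, mul_sub, mul_add, mul_smul_comm, mul_smul_comm, mul_one]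
  simp only [AddMonoidHom.mulRight_apply, mul_assoc]
  abel

theorem mul_inf_eq_zero (hA : IsOrthSubring A) {c u v : R} (hcA : c ∈ A) (hc : 0 ≤ c)
    (huA : u ∈ A) (hvA : v ∈ A) (hu : 0 ≤ u) (hv : 0 ≤ v) (h : u ⊓ v = 0) : c * u ⊓ v = 0 := by
  have hr : 0 ≤ c * u ⊓ v := le_inf (hA.mul_nonneg c u hc hu) hv
  refine le_antisymm (hA.nonpos_of_forall_le_mul_left hcA hc (D := {u, v}) ?_
    (Set.insert_nonempty u {v}) (h ▸ isGLB_pair) ?_) hr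
  · rintro x (rfl | rfl) <;> assumption
  · rintro x (rfl | rfl) <;> rw [add_mul, one_mul]
    · exact inf_le_left.trans (le_add_of_nonneg_left hu)
    · exact inf_le_right.trans (le_add_of_nonneg_right (hA.mul_nonneg c x hc hv))

theorem mul_right_inf_eq_zero (hA : IsOrthSubring A) {c u v : R} (hcA : c ∈ A) (hc : 0 ≤ c)
    (huA : u ∈ A) (hvA : v ∈ A) (hu : 0 ≤ u) (hv : 0 ≤ v) (h : u ⊓ v = 0) : u * c ⊓ v = 0 := by
  have hr : 0 ≤ u * c ⊓ v := le_inf (hA.mul_nonneg u c hu hc) hv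
  refine le_antisymm (hA.nonpos_of_forall_le_mul_right hcA hc (D := {u, v}) ?_
    (Set.insert_nonempty u {v}) (h ▸ isGLB_pair) ?_) hr
  · rintro x (rfl | rfl) <;> assumption
  · rintro x (rfl | rfl) <;> rw [mul_add, mul_one]
    · exact inf_le_left.trans (le_add_of_nonneg_left hu)
    · exact inf_le_right.trans (le_add_of_nonneg_right (hA.mul_nonneg x c hv hc))

theorem sub_inf_inf_sub_inf (x y : R) : (x - x ⊓ y) ⊓ (y - x ⊓ y) = 0 := by
  rw [← inf_sub, sub_self]

theorem mul_inf_one_le (hA : IsOrthSubring A) {c u : R} (hcA : c ∈ A) (hc : 0 ≤ c)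
    (huA : u ∈ A) (hu : 0 ≤ u) : c * u ⊓ 1 ≤ (1 + c) * (u ⊓ 1) := by
  have h1 := hA.one_nonneg
  have hm : 0 ≤ u ⊓ 1 := le_inf hu h1
  have hmA : u ⊓ 1 ∈ A := hA.mem_of_nonneg_of_le hm inf_le_left huA
  have hu' : 0 ≤ u - u ⊓ 1 := sub_nonneg.2 inf_le_left
  have hv' : 0 ≤ 1 - u ⊓ 1 := sub_nonneg.2 inf_le_right
  have hcu' := hA.mul_nonneg c _ hc hu'
  have hdisj := hA.mul_inf_eq_zero hcA hc (A.sub_mem huA hmA) (A.sub_mem A.one_mem hmA) hu' hv'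
    (sub_inf_inf_sub_inf u 1)
  have h2 : c * (u - u ⊓ 1) ⊓ 1 ≤ u ⊓ 1 := by
    have := inf_add_le_of_nonneg hcu' hv' hm
    rw [hdisj, zero_add, sub_add_cancel] at this
    exact this.trans inf_le_right
  have h3 := inf_add_le_of_nonneg h1 hcu' (hA.mul_nonneg c _ hc hm)
  rw [← mul_add, sub_add_cancel, inf_comm, inf_comm 1] at h3
  rw [add_mul, one_mul]
  exact h3.trans (add_le_add h2 inf_le_right)

theorem mul_right_inf_one_le (hA : IsOrthSubring A) {c u : R} (hcA : c ∈ A) (hc : 0 ≤ c)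
    (huA : u ∈ A) (hu : 0 ≤ u) : u * c ⊓ 1 ≤ (u ⊓ 1) * (1 + c) := by
  have h1 := hA.one_nonneg
  have hm : 0 ≤ u ⊓ 1 := le_inf hu h1
  have hmA : u ⊓ 1 ∈ A := hA.mem_of_nonneg_of_le hm inf_le_left huA
  have hu' : 0 ≤ u - u ⊓ 1 := sub_nonneg.2 inf_le_left
  have hv' : 0 ≤ 1 - u ⊓ 1 := sub_nonneg.2 inf_le_right
  have hcu' := hA.mul_nonneg _ c hu' hc
  have hdisj := hA.mul_right_inf_eq_zero hcA hc (A.sub_mem huA hmA) (A.sub_mem A.one_mem hmA)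
    hu' hv' (sub_inf_inf_sub_inf u 1)
  have h2 : (u - u ⊓ 1) * c ⊓ 1 ≤ u ⊓ 1 := by
    have := inf_add_le_of_nonneg hcu' hv' hm
    rw [hdisj, zero_add, sub_add_cancel] at this
    exact this.trans inf_le_right
  have h3 := inf_add_le_of_nonneg h1 hcu' (hA.mul_nonneg _ c hm hc)
  rw [← add_mul, sub_add_cancel, inf_comm, inf_comm 1] at h3
  rw [mul_add, mul_one]
  exact h3.trans (add_le_add h2 inf_le_right)

theorem mul_inf_one_le_add (hA : IsOrthSubring A) {u v : R} (huA : u ∈ A) (hu : 0 ≤ u)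
    (hvA : v ∈ A) (hv : 0 ≤ v) : u * v ⊓ 1 ≤ (u ⊓ 1) + (v ⊓ 1) := by
  have h1 := hA.one_nonneg
  have hm : 0 ≤ u ⊓ 1 := le_inf hu h1
  have hmA : u ⊓ 1 ∈ A := hA.mem_of_nonneg_of_le hm inf_le_left huA
  have hu' : 0 ≤ u - u ⊓ 1 := sub_nonneg.2 inf_le_left
  have hv' : 0 ≤ 1 - u ⊓ 1 := sub_nonneg.2 inf_le_right
  have huv' := hA.mul_nonneg _ v hu' hv
  have hdisj := hA.mul_right_inf_eq_zero hvA hv (A.sub_mem huA hmA) (A.sub_mem A.one_mem hmA)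
    hu' hv' (sub_inf_inf_sub_inf u 1)
  have h2 : (u - u ⊓ 1) * v ⊓ 1 ≤ u ⊓ 1 := by
    have := inf_add_le_of_nonneg huv' hv' hm
    rw [hdisj, zero_add, sub_add_cancel] at this
    exact this.trans inf_le_right
  have h3 := inf_add_le_of_nonneg h1 huv' (hA.mul_nonneg _ v hm hv)
  rw [← add_mul, sub_add_cancel, inf_comm, inf_comm 1, inf_comm 1] at h3
  refine h3.trans (add_le_add h2 (inf_le_inf_right 1 ?_))
  simpa using hA.mul_le_mul_right hv (inf_le_right : u ⊓ 1 ≤ 1)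

/-- A positive element of `A` is the supremum of its truncations at multiples of `1`. -/
theorem le_of_forall_inf_nsmul_one_le (hA : IsOrthSubring A) {z g : R} (hzA : z ∈ A)
    (h : ∀ n : ℕ, z ⊓ n • 1 ≤ g) : z ≤ g := by
  rw [← sub_nonpos]
  have hz2 := hA.sq_nonneg z hzA
  have key : ∀ n : ℕ, (n + 1) • (z - g) ≤ z * z := fun n => by
    obtain ⟨q, hq⟩ := hA.div n (z * z)
    have hq0 : 0 ≤ q := nonneg_of_succ_nsmul_nonneg (hq ▸ hz2)
    rw [← hq]
    refine nsmul_le_nsmul_right ?_ _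
    have h1 : z - (n + 1) • 1 ≤ q := by
      refine le_of_succ_nsmul_le (n := n) ?_
      refine le_of_succ_nsmul_le (n := 1) ?_
      have h2 := hA.nsmul_two_mul_le hzA (n + 1)
      rw [hq, ← sub_nonneg]
      have h3 : 0 ≤ z * z + ((n + 1) * (n + 1)) • (1 : R) :=
        add_nonneg hz2 (nsmul_nonneg hA.one_nonneg _)
      convert add_nonneg (sub_nonneg.2 h2) h3 using 1
      simp only [smul_sub, smul_smul, one_add_one_eq_two]
      rw [two_nsmul, two_mul ((n + 1) * (n + 1)), add_smul]
      abel
    calc z - g ≤ z - z ⊓ (n + 1) • 1 := sub_le_sub_left (h (n + 1)) z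
      _ ≤ q := by
        rw [sub_inf, sub_self]
        exact sup_le hq0 h1
  refine hA.arch _ (z * z) fun n => ?_
  cases n with
  | zero => simpa using hz2
  | succ n => exact key n

theorem mem_of_uoTendsto (hA : IsOrthSubring A) {ι : Type*} [Preorder ι] {S : ι → R} {L : R}
    (hS : ∀ a, S a ∈ A) (h : UOTendsto S L) : L ∈ A := by
  suffices |L| ∈ A from hA.solid L _ this le_rfl
  have hL := abs_nonneg L
  refine hA.mem_of_forall_le_sq _ hL fun n => ?_
  obtain ⟨D, -, -, hD, hDS⟩ := h |L| hL
  rw [← sub_nonpos]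
  have hbound : ∀ d ∈ D, (2 * n) • |L| - (|L| * |L| + (n * n) • 1) ≤ (2 * n) • d := fun d hd => by
    obtain ⟨a, ha⟩ := hDS d hd
    have had := (le_abs_self _).trans (ha a le_rfl)
    rw [sub_zero] at had
    have hb : 0 ≤ |L| ⊓ |S a| := le_inf hL (abs_nonneg _)
    have hbA := hA.mem_of_nonneg_of_le hb inf_le_right (hA.abs_mem (hS a))
    have hLd : |L| ≤ |L| ⊓ |S a| + d := by
      have hLS : |L| ≤ |S a| + |S a - L| := by
        simpa [abs_sub_comm] using abs_add_le (S a) (L - S a)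
      calc |L| = |L| ⊓ (|S a| + |S a - L|) := (inf_eq_left.2 hLS).symm
        _ ≤ |L| ⊓ |S a| + |L| ⊓ |S a - L| :=
          inf_add_le_of_nonneg hL (abs_nonneg _) (abs_nonneg _)
        _ ≤ |L| ⊓ |S a| + d := by
          rw [inf_comm _ |S a - L|]
          exact add_le_add_right had _
    have hbb : (|L| ⊓ |S a|) * (|L| ⊓ |S a|) ≤ |L| * |L| :=
      (hA.mul_le_mul_right hb inf_le_left).trans (hA.mul_le_mul_left hL inf_le_left)
    rw [sub_le_iff_le_add]
    calc (2 * n) • |L| ≤ (2 * n) • (|L| ⊓ |S a|) + (2 * n) • d := by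
          rw [← smul_add]
          exact nsmul_le_nsmul_right hLd _
      _ ≤ (|L| * |L| + (n * n) • 1) + (2 * n) • d := by
          gcongr
          exact (hA.nsmul_two_mul_le hbA n).trans (add_le_add_left hbb _)
      _ = _ := add_comm _ _
  cases n with
  | zero => simpa using hA.mul_nonneg _ _ hL hL
  | succ n => exact hA.nonpos_of_forall_le_nsmul (n := 2 * n + 1) hD hbound

/-- Unbounded order convergence is tested on the unit. -/
theorem exists_of_uoTendsto (hA : IsOrthSubring A) {ι : Type*} [Preorder ι] {S : ι → R} {L : R}
    (h : UOTendsto S L) :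
    ∃ D : Set R, D ⊆ A ∧ D.Nonempty ∧ DirectedOn (· ≥ ·) D ∧ IsGLB D 0 ∧
      ∀ d ∈ D, ∃ a₀, ∀ a, a₀ ≤ a → |S a - L| ⊓ 1 ≤ d := by
  obtain ⟨D, hne, hdir, hD, hDS⟩ := h 1 hA.one_nonneg
  refine ⟨(· ⊓ 1) '' D, ?_, hne.image _, ?_, ⟨?_, fun z hz => hD.2 fun d hd => ?_⟩, ?_⟩
  · rintro _ ⟨d, hd, rfl⟩
    exact hA.mem_of_nonneg_of_le (le_inf (hD.1 hd) hA.one_nonneg) inf_le_right A.one_mem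
  · rintro _ ⟨d, hd, rfl⟩ _ ⟨e, he, rfl⟩
    obtain ⟨g, hg, hgd, hge⟩ := hdir d hd e he
    exact ⟨_, ⟨g, hg, rfl⟩, inf_le_inf_right 1 hgd, inf_le_inf_right 1 hge⟩
  · rintro _ ⟨d, hd, rfl⟩
    exact le_inf (hD.1 hd) hA.one_nonneg
  · exact (hz ⟨d, hd, rfl⟩).trans inf_le_left
  · rintro _ ⟨d, hd, rfl⟩
    obtain ⟨a₀, ha₀⟩ := hDS d hd
    refine ⟨a₀, fun a ha => le_inf ?_ inf_le_right⟩
    have := (le_abs_self _).trans (ha₀ a ha)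
    rwa [sub_zero] at this

theorem abs_mul_sub_mul_inf_one_le (hA : IsOrthSubring A) {s t p q d e : R} (hs : s ∈ A)
    (ht : t ∈ A) (hp : p ∈ A) (hq : q ∈ A) (hd : |s - p| ⊓ 1 ≤ d) (he : |t - q| ⊓ 1 ≤ e) :
    |s * t - p * q| ⊓ 1 ≤ (1 + (1 + |p|)) * e + d * (1 + (1 + |q|)) := by
  have h1 := hA.one_nonneg
  have huA := hA.abs_mem (A.sub_mem hs hp)
  have hvA := hA.abs_mem (A.sub_mem ht hq)
  have hpA := hA.abs_mem hp
  have hqA := hA.abs_mem hq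
  have hu := abs_nonneg (s - p)
  have hv := abs_nonneg (t - q)
  have hp0 := abs_nonneg p
  have hq0 := abs_nonneg q
  have huv := hA.mul_nonneg _ _ hu hv
  have hpv := hA.mul_nonneg _ _ hp0 hv
  have huq := hA.mul_nonneg _ _ hu hq0
  have habs : |s * t - p * q| ≤ |s - p| * |t - q| + |p| * |t - q| + |s - p| * |q| := by
    have hexp : s * t - p * q = (s - p) * (t - q) + p * (t - q) + (s - p) * q := by noncomm_ring
    rw [hexp]
    refine (abs_add_le _ _).trans (add_le_add ((abs_add_le _ _).trans (add_le_add ?_ ?_)) ?_) <;>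
    exact hA.abs_mul_le _ _
  have h₁ : |s - p| * |t - q| ⊓ 1 ≤ d + e :=
    (hA.mul_inf_one_le_add huA hu hvA hv).trans (add_le_add hd he)
  have h₂ : |p| * |t - q| ⊓ 1 ≤ (1 + |p|) * e :=
    (hA.mul_inf_one_le hpA hp0 hvA hv).trans (hA.mul_le_mul_left (add_nonneg h1 hp0) he)
  have h₃ : |s - p| * |q| ⊓ 1 ≤ d * (1 + |q|) :=
    (hA.mul_right_inf_one_le hqA hq0 huA hu).trans (hA.mul_le_mul_right (add_nonneg h1 hq0) hd)
  calc |s * t - p * q| ⊓ 1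
      ≤ 1 ⊓ (|s - p| * |t - q| + |p| * |t - q| + |s - p| * |q|) := by
        rw [inf_comm]; exact inf_le_inf_left 1 habs
    _ ≤ 1 ⊓ (|s - p| * |t - q| + |p| * |t - q|) + 1 ⊓ (|s - p| * |q|) :=
        inf_add_le_of_nonneg h1 (add_nonneg huv hpv) huq
    _ ≤ 1 ⊓ (|s - p| * |t - q|) + 1 ⊓ (|p| * |t - q|) + 1 ⊓ (|s - p| * |q|) :=
        add_le_add_left (inf_add_le_of_nonneg h1 huv hpv) _
    _ ≤ d + e + (1 + |p|) * e + d * (1 + |q|) := by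
        rw [inf_comm 1, inf_comm 1, inf_comm 1]
        exact add_le_add (add_le_add h₁ h₂) h₃
    _ = _ := by noncomm_ring

theorem inf_le_sub_add_nsmul (hA : IsOrthSubring A) {w y g b : R} (hwA : w ∈ A) (hw : 0 ≤ w)
    (hy : 0 ≤ y) (hg : ∀ m : ℕ, y ⊓ m • 1 ≤ g) (hb : w ⊓ 1 ≤ b) (n : ℕ) :
    w ⊓ y ≤ g - y ⊓ n • 1 + n • b := by
  have hz : 0 ≤ w ⊓ y := le_inf hw hy
  refine hA.le_of_forall_inf_nsmul_one_le (hA.mem_of_nonneg_of_le hz inf_le_left hwA) fun m => ?_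
  rw [sub_add_eq_add_sub, le_sub_iff_add_le, ← inf_add_sup, add_comm g]
  refine add_le_add ?_ (sup_le ((inf_le_inf_right _ inf_le_right).trans (hg m)) (hg n))
  calc w ⊓ y ⊓ m • 1 ⊓ (y ⊓ n • 1) ≤ w ⊓ n • 1 :=
        le_inf (inf_le_left.trans (inf_le_left.trans inf_le_left)) (inf_le_right.trans inf_le_right)
    _ ≤ n • (w ⊓ 1) := inf_nsmul_le hw hA.one_nonneg n
    _ ≤ n • b := nsmul_le_nsmul_right hb n

theorem uoTendsto_mul (hA : IsOrthSubring A) {ι κ : Type*} [Preorder ι] [Preorder κ]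
    {S : ι → R} {T : κ → R} {P Q : R} (hS : ∀ a, S a ∈ A) (hT : ∀ b, T b ∈ A)
    (hSP : UOTendsto S P) (hTQ : UOTendsto T Q) :
    UOTendsto (fun p : ι × κ => S p.1 * T p.2) (P * Q) := by
  have hP := hA.mem_of_uoTendsto hS hSP
  have hQ := hA.mem_of_uoTendsto hT hTQ
  have hP0 := add_nonneg hA.one_nonneg (abs_nonneg P)
  have hQ0 := add_nonneg hA.one_nonneg (abs_nonneg Q)
  have hPA := A.add_mem A.one_mem (hA.abs_mem hP)
  have hQA := A.add_mem A.one_mem (hA.abs_mem hQ)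
  obtain ⟨D, hDA, hDne, hDdir, hD, hDS⟩ := hA.exists_of_uoTendsto hSP
  obtain ⟨F, hFA, hFne, hFdir, hF, hFT⟩ := hA.exists_of_uoTendsto hTQ
  intro y hy
  refine ⟨{g | ∃ d ∈ D, ∃ e ∈ F, ∀ p : ι × κ, |S p.1 - P| ⊓ 1 ≤ d → |T p.2 - Q| ⊓ 1 ≤ e →
    |S p.1 * T p.2 - P * Q| ⊓ y ≤ g}, ?_, ?_, ⟨?_, fun z hz => ?_⟩, ?_⟩
  · obtain ⟨d, hd⟩ := hDne
    obtain ⟨e, he⟩ := hFne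
    exact ⟨y, d, hd, e, he, fun _ _ _ => inf_le_right⟩
  · rintro g ⟨d, hd, e, he, h⟩ g' ⟨d', hd', e', he', h'⟩
    obtain ⟨d₁, hd₁, hdd, hdd'⟩ := hDdir d hd d' hd'
    obtain ⟨e₁, he₁, hee, hee'⟩ := hFdir e he e' he'
    exact ⟨g ⊓ g', ⟨d₁, hd₁, e₁, he₁, fun p hp hq =>
      le_inf (h p (hp.trans hdd) (hq.trans hee)) (h' p (hp.trans hdd') (hq.trans hee'))⟩,
      inf_le_left, inf_le_right⟩
  · rintro g ⟨d, hd, e, he, h⟩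
    obtain ⟨a, ha⟩ := hDS d hd
    obtain ⟨b, hb⟩ := hFT e he
    exact (le_inf (abs_nonneg _) hy).trans (h (a, b) (ha a le_rfl) (hb b le_rfl))
  · have hstep : ∀ g, (∀ m : ℕ, y ⊓ m • 1 ≤ g) → ∀ n : ℕ, y ⊓ n • 1 ≤ g - z := fun g hg n => by
      have hz' : ∀ d ∈ D, ∀ e ∈ F,
          z - g + y ⊓ n • 1 ≤ n • ((1 + (1 + |P|)) * e + d * (1 + (1 + |Q|))) :=
        fun d hd e he => by
          have := hz ⟨d, hd, e, he, fun p hp hq => hA.inf_le_sub_add_nsmul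
            (hA.abs_mem (A.sub_mem (A.mul_mem (hS p.1) (hT p.2)) (A.mul_mem hP hQ)))
            (abs_nonneg _) hy hg
            (hA.abs_mul_sub_mul_inf_one_le (hS p.1) (hT p.2) hP hQ hp hq) n⟩
          rw [← sub_nonneg] at this ⊢
          convert this using 1
          abel
      rw [← sub_nonpos, sub_sub_eq_add_sub, add_comm, add_sub_right_comm]
      obtain ⟨w, hw⟩ : ∃ w, w = z - g + y ⊓ n • 1 := ⟨_, rfl⟩
      rw [← hw] at hz' ⊢
      cases n with
      | zero =>
        obtain ⟨d, hd⟩ := hDne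
        obtain ⟨e, he⟩ := hFne
        simpa using hz' d hd e he
      | succ n =>
        obtain ⟨w, rfl⟩ := hA.div n w
        refine nsmul_nonpos (hA.nonpos_of_forall_le_mul_left hPA hP0 hFA hFne hF fun e he => ?_) _
        rw [← sub_nonpos]
        refine hA.nonpos_of_forall_le_mul_right hQA hQ0 hDA hDne hD fun d hd => ?_
        rw [sub_le_iff_le_add']
        exact le_of_succ_nsmul_le (hz' d hd e he)
    have hbound : ∀ k n : ℕ, y ⊓ n • 1 ≤ y - k • z := fun k => by
      induction k with
      | zero => simp
      | succ k ih =>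
        rw [succ_nsmul, ← sub_sub]
        exact hstep _ ih
    refine hA.arch z y fun k => ?_
    simpa [hy] using hbound k 0
  · rintro g ⟨d, hd, e, he, h⟩
    obtain ⟨a, ha⟩ := hDS d hd
    obtain ⟨b, hb⟩ := hFT e he
    refine ⟨(a, b), fun p hp => ?_⟩
    rw [sub_zero, abs_of_nonneg (le_inf (abs_nonneg _) hy)]
    exact h p (ha _ hp.1) (hb _ hp.2)

end IsOrthSubring

end OrthSubring

namespace IsLobLattice

variable {E 𝕃 : Type*} [Lattice E] [AddCommGroup E] [IsOrderedAddMonoid E] [Module ℝ E]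
  [Lattice 𝕃] [AddCommGroup 𝕃] [Module ℝ 𝕃]
  {j : 𝕃 →ₗ[ℝ] E →ₗ[ℝ] E}

theorem isOrderBoundedMap (hj : IsLobLattice E 𝕃 j) (X : 𝕃) : IsOrderBoundedMap (j X) :=
  (hj.mem_range_iff _).1 ⟨X, rfl⟩

theorem exists_comp (hj : IsLobLattice E 𝕃 j) (X Y : 𝕃) : ∃ Z, j Z = (j X).comp (j Y) :=
  (hj.mem_range_iff _).2 ((hj.isOrderBoundedMap X).comp (hj.isOrderBoundedMap Y))

theorem exists_id (hj : IsLobLattice E 𝕃 j) : ∃ Z, j Z = LinearMap.id :=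
  (hj.mem_range_iff _).2 isOrderBoundedMap_id

/-- The ring structure on the order bounded operators given by composition. -/
noncomputable abbrev ring (hj : IsLobLattice E 𝕃 j) : Ring 𝕃 :=
  letI : Mul 𝕃 := ⟨fun X Y => (hj.exists_comp X Y).choose⟩
  letI : One 𝕃 := ⟨hj.exists_id.choose⟩
  have hmul (X Y : 𝕃) : j (X * Y) = (j X).comp (j Y) := (hj.exists_comp X Y).choose_spec
  have hone : j 1 = LinearMap.id := hj.exists_id.choose_spec
  { (inferInstance : AddCommGroup 𝕃), (inferInstance : Mul 𝕃), (inferInstance : One 𝕃) with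
    left_distrib := fun X Y Z => hj.inj (by
      simp only [map_add, hmul, LinearMap.comp_add])
    right_distrib := fun X Y Z => hj.inj (by
      simp only [map_add, hmul, LinearMap.add_comp])
    zero_mul := fun X => hj.inj (by simp only [hmul, map_zero, LinearMap.zero_comp])
    mul_zero := fun X => hj.inj (by simp only [hmul, map_zero, LinearMap.comp_zero])
    mul_assoc := fun X Y Z => hj.inj (by simp only [hmul, LinearMap.comp_assoc])
    one_mul := fun X => hj.inj (by simp only [hmul, hone, LinearMap.id_comp])
    mul_one := fun X => hj.inj (by simp only [hmul, hone, LinearMap.comp_id]) }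

theorem map_mul (hj : IsLobLattice E 𝕃 j) (X Y : 𝕃) :
    letI := hj.ring
    j (X * Y) = (j X).comp (j Y) :=
  (hj.exists_comp X Y).choose_spec

theorem map_one (hj : IsLobLattice E 𝕃 j) :
    letI := hj.ring
    j 1 = LinearMap.id :=
  hj.exists_id.choose_spec

/-- The subring of orthomorphisms. -/
noncomputable def orthSubring (hj : IsLobLattice E 𝕃 j) :
    letI := hj.ring
    Subring 𝕃 :=
  letI := hj.ring
  { carrier := {X | IsOrthomorphism (j X)}
    mul_mem' := fun {X Y} hX hY => by
      rw [Set.mem_ofPred_eq, hj.map_mul]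
      exact hX.comp hY
    one_mem' := by
      rw [Set.mem_ofPred_eq, hj.map_one]
      exact isOrthomorphism_id
    add_mem' := fun {X Y} hX hY => by
      rw [Set.mem_ofPred_eq, map_add]
      exact hX.add hY
    zero_mem' := by
      rw [Set.mem_ofPred_eq, map_zero]
      exact isOrthomorphism_zero
    neg_mem' := fun {X} hX => by
      rw [Set.mem_ofPred_eq, map_neg]
      exact hX.neg }

theorem nonneg_iff (hj : IsLobLattice E 𝕃 j) {X : 𝕃} : 0 ≤ X ↔ ∀ x, 0 ≤ x → 0 ≤ j X x := by
  simp [hj.le_iff]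

theorem abs_map_le (hj : IsLobLattice E 𝕃 j) {X Z : 𝕃} (h : |X| ≤ Z) (x : E) :
    |j X x| ≤ j Z |x| := by
  obtain ⟨h₁, h₂⟩ := abs_le'.1 h
  have key : ∀ y, 0 ≤ y → |j X y| ≤ j Z y := fun y hy =>
    abs_le'.2 ⟨(hj.le_iff _ _).1 h₁ y hy, by simpa using (hj.le_iff _ _).1 h₂ y hy⟩
  calc |j X x| = |j X x⁺ + -j X x⁻| := by
        rw [← sub_eq_add_neg, ← map_sub, posPart_sub_negPart]
    _ ≤ |j X x⁺| + |j X x⁻| := (abs_add_le _ _).trans_eq (by rw [abs_neg])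
    _ ≤ j Z x⁺ + j Z x⁻ := add_le_add (key _ (posPart_nonneg x)) (key _ (negPart_nonneg x))
    _ = j Z |x| := by rw [← map_add, posPart_add_negPart]

theorem isOrthSubring [IsOrderedAddMonoid 𝕃] (hj : IsLobLattice E 𝕃 j)
    (hDC : DedekindComplete E) :
    letI := hj.ring
    IsOrthSubring hj.orthSubring :=
  letI := hj.ring
  { arch := fun X Y h => by
      refine (hj.le_iff _ _).2 fun x hx => ?_
      rw [map_zero, LinearMap.zero_apply]
      exact hDC.nonpos_of_forall_nsmul_le (y := j Y x) fun n => by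
        simpa only [map_nsmul, LinearMap.smul_apply] using (hj.le_iff _ _).1 (h n) x hx
    div := fun n X => ⟨((n + 1 : ℕ) : ℝ)⁻¹ • X, by
      rw [← Nat.cast_smul_eq_nsmul ℝ, smul_inv_smul₀ (Nat.cast_ne_zero.2 n.succ_ne_zero)]⟩
    one_nonneg := hj.nonneg_iff.2 fun x hx => by rwa [hj.map_one]
    mul_nonneg := fun X Y hX hY => hj.nonneg_iff.2 fun x hx => by
      rw [hj.map_mul]
      exact hj.nonneg_iff.1 hX _ (hj.nonneg_iff.1 hY x hx)
    sq_nonneg := fun X hX => hj.nonneg_iff.2 fun x hx => by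
      rw [hj.map_mul]
      exact IsOrthomorphism.map_map_nonneg hDC hX hx
    solid := fun X Z hZ h => by
      refine ⟨hj.isOrderBoundedMap X, fun x y hxy => ?_⟩
      refine inf_eq_zero_of_le (abs_nonneg _) ((hj.abs_map_le h x).trans (le_abs_self _))
        (abs_nonneg y) ?_
      exact hZ.2 _ y (by rwa [abs_abs])
    left_cancel := fun C hC hC0 X _ h => hj.nonneg_iff.2 fun x hx => by
      have hCX := hj.nonneg_iff.1 h x hx
      rw [hj.map_mul, map_add, hj.map_one] at hCX
      exact IsOrthomorphism.nonneg_of_add_map_nonneg hC (hj.nonneg_iff.1 hC0) hCX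
    right_cancel := fun C _ hC0 X hX h => hj.nonneg_iff.2 fun x hx => by
      have hXC := hj.nonneg_iff.1 h x hx
      rw [hj.map_mul, map_add, hj.map_one] at hXC
      exact IsOrthomorphism.map_nonneg_of_le hDC hX hXC hx
        (le_add_of_nonneg_right (hj.nonneg_iff.1 hC0 x hx))
    mem_of_forall_le_sq := fun X hX h => by
      refine ⟨hj.isOrderBoundedMap X, fun x y hxy => ?_⟩
      have hXx := hj.nonneg_iff.1 hX _ (abs_nonneg x)
      have ht : 0 ≤ j X |x| ⊓ |y| := le_inf hXx (abs_nonneg y)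
      have hd : j X |x| ⊓ |y| ⊓ |x| = 0 :=
        inf_eq_zero_of_le ht inf_le_right (abs_nonneg x) (by rwa [inf_comm])
      refine inf_eq_zero_of_le (abs_nonneg _) (hj.abs_map_le (abs_of_nonneg hX).le x)
        (abs_nonneg y) (le_antisymm ?_ ht)
      refine hDC.nonpos_of_forall_nsmul_le (y := j X (j X |x|)) fun n => ?_
      refine (nsmul_le_nsmul_left ht (show n ≤ 2 * n by omega)).trans ?_
      have hn := (hj.le_iff _ _).1 (h n) |x| (abs_nonneg x)
      rw [map_add, hj.map_mul, map_nsmul, map_nsmul, hj.map_one] at hn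
      refine le_of_le_add_of_inf_eq_zero (c := (n * n) • |x|) (nsmul_nonneg ht _)
        (hj.nonneg_iff.1 hX _ hXx) (nsmul_nonneg (abs_nonneg x) _) ?_
        ((nsmul_le_nsmul_right inf_le_left _).trans hn)
      refine inf_nsmul_eq_zero (nsmul_nonneg ht _) (abs_nonneg x) ?_ _
      rw [inf_comm]
      exact inf_nsmul_eq_zero (abs_nonneg x) ht (by rwa [inf_comm]) _ }

end IsLobLattice

/-- Let `E` be a Dedekind complete vector lattice.  If `(S_α)` and
`(T_β)` are nets of orthomorphisms that are unbounded order convergent in `L_ob(E)` to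
`S` and `T` respectively, then `S` and `T` are orthomorphisms and `(S_α ∘ T_β)` is
unbounded order convergent to `S ∘ T` in `L_ob(E)`.  Here `(𝕃, j)` realizes
`L_ob(E)`. -/
theorem stmt12 {E 𝕃 : Type*}
    [Lattice E] [AddCommGroup E] [CovariantClass E E (· + ·) (· ≤ ·)] [Module ℝ E]
    [Lattice 𝕃] [AddCommGroup 𝕃] [CovariantClass 𝕃 𝕃 (· + ·) (· ≤ ·)] [Module ℝ 𝕃]
    (j : 𝕃 →ₗ[ℝ] E →ₗ[ℝ] E) (hj : IsLobLattice E 𝕃 j)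
    (hDC : DedekindComplete E)
    {ι κ : Type*} [Preorder ι] [Preorder κ]
    (S : ι → 𝕃) (hS : ∀ a, IsOrthomorphism (j (S a)))
    (Slim : 𝕃) (hSconv : UOTendsto S Slim)
    (T : κ → 𝕃) (hT : ∀ b, IsOrthomorphism (j (T b)))
    (Tlim : 𝕃) (hTconv : UOTendsto T Tlim) :
    IsOrthomorphism (j Slim) ∧ IsOrthomorphism (j Tlim) ∧
    ∀ C : ι × κ → 𝕃, (∀ p : ι × κ, j (C p) = (j (S p.1)).comp (j (T p.2))) →
      ∀ P : 𝕃, j P = (j Slim).comp (j Tlim) → UOTendsto C P := by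
  have : IsOrderedAddMonoid E :=
    { add_le_add_left := fun a b h c => by
        simpa only [add_comm _ c] using CovariantClass.elim (μ := (· + ·)) c h }
  have : IsOrderedAddMonoid 𝕃 :=
    { add_le_add_left := fun a b h c => by
        simpa only [add_comm _ c] using CovariantClass.elim (μ := (· + ·)) c h }
  let := hj.ring
  have hA := hj.isOrthSubring hDC
  refine ⟨hA.mem_of_uoTendsto hS hSconv, hA.mem_of_uoTendsto hT hTconv, fun C hC P hP => ?_⟩
  have hCST : C = fun p => S p.1 * T p.2 :=
    funext fun p => hj.inj ((hC p).trans (hj.map_mul _ _).symm)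
  have hPST : P = Slim * Tlim := hj.inj (hP.trans (hj.map_mul _ _).symm)
  rw [hCST, hPST]
  exact hA.uoTendsto_mul hS hT hSconv hTconv
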